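/- Let l ≥ 1 be an integer, let b, c > 0 be real, let {z̃_j}_{j=1}^{l+1} be the (distinct) complex roots of q_l (each with negative real part), and set β_l = l(l+1). Then for every s ∈ ℂ with Re s > 0, setting z = s·b/c: ∫₀^∞ e^(−s t) · (c/b) · ∑_{j=1}^{l+1} ( z̃_j³/(z̃_j² + β_l) ) · e^{(c/b) z̃_j t} dt + ∑_{j=1}^{l+1} z̃_j²/(z̃_j² + β_l) = z·( z·k_l(z)/(k_l(z) + z·k_l′(z)) + 1 ). (That is, the kernel ρ_l(t) = (c/b)∑_j (z̃_j³/(z̃_j²+β_l)) e^{(c/b) z̃_j t} + δ(t)·∑_j z̃_j²/(z̃_j²+β_l) has Laplace transform z(z·k_l(z)/(k_l(z)+z·k_l′(z)) + 1) with z = s b/c.) -/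

import Mathlib

open Polynomial MeasureTheory

/-- The polynomial `p_l(z) = ∑_{k=0}^{l} ((l+k)! / (2^k k! (l−k)!)) z^{l−k}`. -/
noncomputable def pPoly (l : ℕ) : Polynomial ℂ :=
  ∑ k ∈ Finset.range (l + 1),
    C (((l + k).factorial : ℂ) / (2 ^ k * (k.factorial : ℂ) * ((l - k).factorial : ℂ))) *
      X ^ (l - k)

/-- The polynomial `q_l(z) = z p_l'(z) − (z + l) p_l(z)`. -/
noncomputable def qPoly (l : ℕ) : Polynomial ℂ :=
  X * derivative (pPoly l) - (X + C (l : ℂ)) * pPoly l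

/-- The modified spherical Bessel function of the second kind,
`k_l(z) = (π/2) e^{−z} p_l(z) / z^{l+1}`. -/
noncomputable def kFun (l : ℕ) : ℂ → ℂ :=
  fun z => (Real.pi : ℂ) / 2 * Complex.exp (-z) * (pPoly l).eval z / z ^ (l + 1)

open Finset in
theorem coeff_pPoly (l m : ℕ) :
    (pPoly l).coeff m = if m ≤ l then
      ((2 * l - m).factorial : ℂ) / (2 ^ (l - m) * ((l - m).factorial : ℂ) * (m.factorial : ℂ))
      else 0 := by
  simp only [pPoly, finsetSum_coeff, coeff_C_mul, coeff_X_pow]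
  split_ifs with h
  · rw [sum_eq_single_of_mem (l - m) (by simp)]
    · rw [if_pos (by omega), mul_one, show l + (l - m) = 2 * l - m by omega,
        show l - (l - m) = m by omega]
    · intro k hk hne
      have := mem_range.mp hk
      rw [if_neg (by omega), mul_zero]
  · exact sum_eq_zero fun k _ => by rw [if_neg (by omega), mul_zero]

theorem coeff_pPoly_of_lt {l m : ℕ} (h : l < m) : (pPoly l).coeff m = 0 := by
  rw [coeff_pPoly, if_neg (by omega)]

theorem coeff_pPoly_self (l : ℕ) : (pPoly l).coeff l = 1 := by
  rw [coeff_pPoly, if_pos le_rfl, show 2 * l - l = l by omega]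
  simp [Nat.factorial_ne_zero]

theorem coeff_pPoly_succ (l m : ℕ) :
    ((m : ℂ) + 1) * (2 * l - m) * (pPoly l).coeff (m + 1) =
      2 * (l - m) * (pPoly l).coeff m := by
  rcases lt_trichotomy m l with h | rfl | h
  · obtain ⟨d, rfl⟩ := Nat.exists_eq_add_of_lt h
    rw [coeff_pPoly, coeff_pPoly, if_pos (by omega), if_pos (by omega),
      show 2 * (m + d + 1) - (m + 1) = m + 2 * d + 1 by omega,
      show 2 * (m + d + 1) - m = m + 2 * d + 1 + 1 by omega,
      show m + d + 1 - (m + 1) = d by omega, show m + d + 1 - m = d + 1 by omega,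
      Nat.factorial_succ (m + 2 * d + 1), Nat.factorial_succ d, Nat.factorial_succ m]
    have h1 : (d.factorial : ℂ) ≠ 0 := by exact_mod_cast Nat.factorial_ne_zero d
    have h2 : (m.factorial : ℂ) ≠ 0 := by exact_mod_cast Nat.factorial_ne_zero m
    have h3 : (d : ℂ) + 1 ≠ 0 := by exact_mod_cast Nat.succ_ne_zero d
    have h4 : (m : ℂ) + 1 ≠ 0 := by exact_mod_cast Nat.succ_ne_zero m
    push_cast
    field_simp
    ring
  · rw [coeff_pPoly_of_lt (Nat.lt_succ_self m)]
    ring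
  · rw [coeff_pPoly_of_lt h, coeff_pPoly_of_lt (by omega)]
    ring

/-- The second-order differential equation satisfied by `p_l`. -/
theorem pPoly_ode (l : ℕ) :
    X * derivative (derivative (pPoly l)) + 2 * C (l : ℂ) * pPoly l =
      2 * (X + C (l : ℂ)) * derivative (pPoly l) := by
  have key : X * derivative (derivative (pPoly l)) + C (2 * l : ℂ) * pPoly l =
      C 2 * (X * derivative (pPoly l)) + C (2 * l : ℂ) * derivative (pPoly l) := by
    ext m
    have := coeff_pPoly_succ l m
    cases m with
    | zero =>
      simp only [coeff_add, mul_coeff_zero, coeff_X_zero, coeff_C_zero, coeff_derivative]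
      push_cast at this ⊢
      linear_combination -this
    | succ m =>
      simp only [coeff_add, coeff_C_mul, coeff_X_mul, coeff_derivative]
      push_cast at this ⊢
      linear_combination -this
  have h2 : (2 : ℂ[X]) = C 2 := (map_ofNat C 2).symm
  rw [C_mul, ← h2] at key
  linear_combination key

/-- The first-order relation between `q_l` and `p_l` inherited from the modified spherical
Bessel equation. -/
theorem X_mul_derivative_qPoly (l : ℕ) :
    X * derivative (qPoly l) =
      (X + C (l : ℂ) + 1) * qPoly l + (X ^ 2 + C (l : ℂ) * (C (l : ℂ) + 1)) * pPoly l := by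
  simp only [qPoly, derivative_sub, derivative_mul, derivative_X, derivative_add, derivative_C]
  linear_combination X * pPoly_ode l

theorem coeff_qPoly_succ (l m : ℕ) :
    (qPoly l).coeff (m + 1) =
      ((m : ℂ) + 1 - l) * (pPoly l).coeff (m + 1) - (pPoly l).coeff m := by
  simp only [qPoly, add_mul, coeff_sub, coeff_add, coeff_X_mul, coeff_C_mul, coeff_derivative]
  ring

theorem qPoly_eq_neg_nodal {l : ℕ} {v : Fin (l + 1) → ℂ} (hinj : Function.Injective v)
    (hroot : ∀ j, (qPoly l).IsRoot (v j)) : qPoly l = -Lagrange.nodal Finset.univ v := by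
  refine Polynomial.eq_of_degree_sub_lt_of_eval_index_eq Finset.univ hinj.injOn ?_ ?_
  · rw [Finset.card_univ, Fintype.card_fin, degree_lt_iff_coeff_zero]
    intro m hm
    obtain ⟨m, rfl⟩ := Nat.exists_eq_succ_of_ne_zero (by omega : m ≠ 0)
    rw [sub_neg_eq_add, coeff_add, coeff_qPoly_succ, coeff_pPoly_of_lt (by omega)]
    rcases (by omega : l = m ∨ l < m) with rfl | h
    · have h1 := (Lagrange.nodal_monic (s := Finset.univ) (v := v)).coeff_natDegree
      rw [Lagrange.natDegree_nodal, Finset.card_univ, Fintype.card_fin] at h1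
      rw [coeff_pPoly_self, h1]
      ring
    · rw [coeff_pPoly_of_lt h, coeff_eq_zero_of_natDegree_lt]
      · ring
      · rw [Lagrange.natDegree_nodal, Finset.card_univ, Fintype.card_fin]
        omega
  · intro i hi
    rw [(hroot i).eq_zero, eval_neg, Lagrange.eval_nodal_at_node hi, neg_zero]

/-- Partial fraction decomposition over distinct simple nodes. -/
theorem eval_div_nodal_eq_sum {F ι : Type*} [Field F] {s : Finset ι}
    {v : ι → F} (hvs : Set.InjOn v s) {P : F[X]} (hP : P.degree < s.card) {x : F}
    (hx : ∀ i ∈ s, x ≠ v i) :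
    P.eval x / (Lagrange.nodal s v).eval x =
      ∑ i ∈ s, P.eval (v i) / (derivative (Lagrange.nodal s v)).eval (v i) / (x - v i) := by
  classical
  rw [div_eq_iff (Lagrange.eval_nodal_not_at_node hx), Lagrange.eq_interpolate hvs hP,
    Lagrange.eval_interpolate_not_at_node _ hx, mul_comm]
  rw [← Lagrange.eq_interpolate hvs hP]
  congr 1
  refine Finset.sum_congr rfl fun i hi => ?_
  rw [Lagrange.nodalWeight_eq_eval_derivative_nodal hi]
  ring

theorem degree_X_mul_sub_lt (l : ℕ) (hl : 1 ≤ l) :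
    (X * (X * derivative (pPoly l) - C (l : ℂ) * pPoly l)).degree <
      ((l + 1 : ℕ) : WithBot ℕ) := by
  rw [degree_lt_iff_coeff_zero]
  intro m hm
  obtain ⟨m, rfl⟩ := Nat.exists_eq_add_of_le' (by omega : 2 ≤ m)
  rw [show m + 2 = (m + 1) + 1 by rfl, coeff_X_mul, coeff_sub, coeff_X_mul, coeff_C_mul,
    coeff_derivative]
  rcases (by omega : l = m + 1 ∨ l < m + 1) with rfl | h
  · push_cast
    ring
  · rw [coeff_pPoly_of_lt h]
    ring

theorem X_mul_sub_div_qPoly_eq_sum {l : ℕ} (hl : 1 ≤ l) {v : Fin (l + 1) → ℂ}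
    (hinj : Function.Injective v) (hroot : ∀ j, (qPoly l).IsRoot (v j)) (hv : ∀ j, v j ≠ 0)
    {x : ℂ} (hx : ∀ j, x ≠ v j) :
    x * (x * (derivative (pPoly l)).eval x - l * (pPoly l).eval x) / (qPoly l).eval x =
      ∑ j, v j ^ 3 / (v j ^ 2 + (l : ℂ) * ((l : ℂ) + 1)) / (x - v j) := by
  have hq := qPoly_eq_neg_nodal hinj hroot
  have h := eval_div_nodal_eq_sum (s := Finset.univ) hinj.injOn
    ((degree_X_mul_sub_lt l hl).trans_eq (by simp)) (fun i _ => hx i)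
  rw [show Lagrange.nodal Finset.univ v = -qPoly l by rw [hq, neg_neg]] at h
  simp only [eval_mul, eval_sub, eval_X, eval_C, eval_neg, derivative_neg, div_neg, neg_div,
    Finset.sum_neg_distrib, neg_inj] at h
  rw [h]
  refine Finset.sum_congr rfl fun j _ => ?_
  congr 1
  have hr : v j * (derivative (pPoly l)).eval (v j) - (v j + l) * (pPoly l).eval (v j) = 0 := by
    simpa [qPoly] using (hroot j).eq_zero
  have hd : v j * (derivative (qPoly l)).eval (v j) =
      (v j ^ 2 + (l : ℂ) * ((l : ℂ) + 1)) * (pPoly l).eval (v j) := by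
    simpa [(hroot j).eq_zero] using congrArg (eval (v j)) (X_mul_derivative_qPoly l)
  have hd0 : (derivative (qPoly l)).eval (v j) ≠ 0 := by
    classical
    rw [hq, derivative_neg, eval_neg, neg_ne_zero]
    have := Lagrange.nodalWeight_ne_zero (s := Finset.univ) hinj.injOn (Finset.mem_univ j)
    rw [Lagrange.nodalWeight_eq_eval_derivative_nodal (Finset.mem_univ j)] at this
    exact fun h => this (by rw [h, inv_zero])
  have hβ : v j ^ 2 + (l : ℂ) * ((l : ℂ) + 1) ≠ 0 := fun h0 => by
    rw [h0, zero_mul] at hd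
    exact mul_ne_zero (hv j) hd0 hd
  rw [div_eq_div_iff hd0 hβ]
  linear_combination v j * (v j ^ 2 + (l : ℂ) * ((l : ℂ) + 1)) * hr - v j ^ 2 * hd

theorem kFun_add_mul_deriv (l : ℕ) {z : ℂ} (hz : z ≠ 0) :
    kFun l z + z * deriv (kFun l) z =
      (Real.pi : ℂ) / 2 * Complex.exp (-z) * (qPoly l).eval z / z ^ (l + 1) := by
  have h := ((((hasDerivAt_neg z).cexp.const_mul ((Real.pi : ℂ) / 2)).mul
    ((pPoly l).hasDerivAt z)).div (hasDerivAt_pow (l + 1) z) (pow_ne_zero _ hz)).deriv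
  change deriv (kFun l) z = _ at h
  rw [h]
  simp only [kFun, qPoly, eval_sub, eval_mul, eval_add, eval_X, eval_C, Pi.mul_apply,
    Nat.add_sub_cancel]
  push_cast
  field_simp
  ring

theorem kFun_div (l : ℕ) {z : ℂ} (hz : z ≠ 0) :
    z * kFun l z / (kFun l z + z * deriv (kFun l) z) =
      z * (pPoly l).eval z / (qPoly l).eval z := by
  have hC : (Real.pi : ℂ) / 2 * Complex.exp (-z) / z ^ (l + 1) ≠ 0 :=
    div_ne_zero (mul_ne_zero (by simp [Real.pi_ne_zero]) (Complex.exp_ne_zero _))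
      (pow_ne_zero _ hz)
  rw [kFun_add_mul_deriv l hz, kFun, ← mul_div_mul_left _ ((qPoly l).eval z) hC]
  congr 1 <;> ring

/-- The Laplace transform at `s` of a finite sum of decaying exponentials. -/
theorem integral_exp_mul_sum_exp {ι : Type*} [Fintype ι] (r a : ι → ℂ) (κ s : ℂ)
    (h : ∀ j, (a j).re < s.re) :
    ∫ t in Set.Ioi (0 : ℝ), Complex.exp (-s * t) * (κ * ∑ j, r j * Complex.exp (a j * t)) =
      ∑ j, κ * r j / (s - a j) := by
  have hre (j : ι) : (a j - s).re < 0 := by simpa using h j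
  have hfun (t : ℝ) : Complex.exp (-s * t) * (κ * ∑ j, r j * Complex.exp (a j * t)) =
      ∑ j, κ * r j * Complex.exp ((a j - s) * t) := by
    rw [Finset.mul_sum, Finset.mul_sum]
    refine Finset.sum_congr rfl fun j _ => ?_
    rw [show (a j - s) * t = -s * t + a j * t by ring, Complex.exp_add]
    ring
  simp_rw [hfun]
  rw [integral_finsetSum _ fun j _ => (integrableOn_exp_mul_complex_Ioi (hre j) 0).const_mul _]
  refine Finset.sum_congr rfl fun j _ => ?_
  rw [integral_const_mul, integral_exp_mul_complex_Ioi (hre j), ← neg_sub (a j) s, div_neg]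
  simp [div_eq_mul_inv]

/-- The NRBC kernel
`ρ_l(t) = (c/b) ∑_j (z̃_j³/(z̃_j²+β_l)) e^{(c/b) z̃_j t} + δ(t) ∑_j z̃_j²/(z̃_j²+β_l)`,
where `{z̃_j}_{j=1}^{l+1}` are the distinct roots of `q_l` (all with negative real part)
and `β_l = l(l+1)`, has Laplace transform `z (z k_l(z)/(k_l(z) + z k_l′(z)) + 1)` with
`z = s b / c`, for every `s` with `Re s > 0`. -/
theorem rho_kernel_laplace_transform (l : ℕ) (hl : 1 ≤ l) (b c : ℝ)
    (hb : 0 < b) (hc : 0 < c) (zt : Fin (l + 1) → ℂ) (hinj : Function.Injective zt)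
    (hroot : ∀ j, (qPoly l).IsRoot (zt j)) (hre : ∀ j, (zt j).re < 0)
    (s : ℂ) (hs : 0 < s.re) :
    (∫ t in Set.Ioi (0 : ℝ),
        Complex.exp (-s * t) *
          ((c / b : ℂ) * ∑ j, (zt j) ^ 3 / ((zt j) ^ 2 + (l : ℂ) * ((l : ℂ) + 1)) *
            Complex.exp ((c / b : ℂ) * zt j * t)))
      + ∑ j, (zt j) ^ 2 / ((zt j) ^ 2 + (l : ℂ) * ((l : ℂ) + 1))
      = (s * b / c) *
          ((s * b / c) * kFun l (s * b / c)
              / (kFun l (s * b / c) + (s * b / c) * deriv (kFun l) (s * b / c)) + 1) := by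
  have hb' : (b : ℂ) ≠ 0 := by exact_mod_cast hb.ne'
  have hc' : (c : ℂ) ≠ 0 := by exact_mod_cast hc.ne'
  have hv (j) : zt j ≠ 0 := fun h => by simpa [h] using hre j
  have hzre : 0 < (s * b / c).re := by
    rw [mul_div_assoc, ← Complex.ofReal_div, Complex.re_mul_ofReal]
    positivity
  have hz : s * b / c ≠ 0 := fun h => by simp [h] at hzre
  have hx (j) : s * b / c ≠ zt j := fun h => by
    have := hre j
    rw [← h] at this
    exact this.not_gt hzre
  have ha (j) : ((c / b : ℂ) * zt j).re < s.re := by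
    rw [← Complex.ofReal_div, Complex.re_ofReal_mul]
    exact (mul_neg_of_pos_of_neg (by positivity) (hre j)).trans hs
  have hq : (qPoly l).eval (s * b / c) ≠ 0 := by
    rw [qPoly_eq_neg_nodal hinj hroot, eval_neg, neg_ne_zero]
    exact Lagrange.eval_nodal_not_at_node fun j _ => hx j
  have hsum_zero : ∑ j, zt j ^ 2 / (zt j ^ 2 + (l : ℂ) * ((l : ℂ) + 1)) = 0 := by
    have h0 := X_mul_sub_div_qPoly_eq_sum hl hinj hroot hv fun j => (hv j).symm
    rw [zero_mul, zero_div] at h0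
    rw [← neg_eq_zero, ← Finset.sum_neg_distrib, h0]
    refine Finset.sum_congr rfl fun j _ => ?_
    have := hv j
    rw [zero_sub, div_neg, div_right_comm, pow_succ (zt j) 2, mul_div_cancel_right₀ _ this]
  rw [integral_exp_mul_sum_exp _ _ _ _ ha, hsum_zero, add_zero, kFun_div l hz]
  have hterm (j) : (c / b : ℂ) * (zt j ^ 3 / (zt j ^ 2 + (l : ℂ) * ((l : ℂ) + 1))) /
      (s - (c / b : ℂ) * zt j) =
      zt j ^ 3 / (zt j ^ 2 + (l : ℂ) * ((l : ℂ) + 1)) / (s * b / c - zt j) := by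
    rw [show s - (c / b : ℂ) * zt j = (c / b : ℂ) * (s * b / c - zt j) by field_simp,
      mul_div_mul_left _ _ (div_ne_zero hc' hb')]
  rw [Finset.sum_congr rfl fun j _ => hterm j,
    ← X_mul_sub_div_qPoly_eq_sum hl hinj hroot hv hx, mul_div_assoc]
  congr 1
  rw [div_add_one hq]
  congr 1
  simp only [qPoly, eval_sub, eval_mul, eval_add, eval_X, eval_C]
  ring
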